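/- arXiv:math/9404204 — 2 statements merged into one kernel-verified Lean document; each statement's English description precedes it below -/
import Mathlib

section
/- Let λ be a regular uncountable cardinal, let T be a set of cardinality strictly less than λ, and let g be a function from pairs of ordinals below λ to T. Then the set {β < λ : for every γ < β, the set {ξ < λ : g(γ,ξ) = g(γ,β)} is stationary in λ} contains a club of λ. -/
open Cardinal

/-- A set of ordinals is unbounded in `lam` if its supremum is `lam`, i.e. it has
elements above any ordinal below `lam`. -/
def UnboundedIn (lam : Ordinal) (S : Set Ordinal) : Prop :=
  ∀ α < lam, ∃ ξ ∈ S, α < ξ ∧ ξ < lam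

/-- A set of ordinals is closed in `lam` if it contains the supremum of each of its
nonempty subsets that is bounded below `lam`. -/
def ClosedIn (lam : Ordinal) (C : Set Ordinal) : Prop :=
  ∀ s : Set Ordinal, s ⊆ C → s.Nonempty → sSup s < lam → sSup s ∈ C

/-- A club of `lam` is a closed unbounded subset of (the set of ordinals below) `lam`. -/
def IsClubIn (lam : Ordinal) (C : Set Ordinal) : Prop :=
  C ⊆ Set.Iio lam ∧ ClosedIn lam C ∧ UnboundedIn lam C

/-- A set of ordinals is stationary in `lam` if it meets every club of `lam`. -/
def StationaryIn (lam : Ordinal) (S : Set Ordinal) : Prop :=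
  ∀ C : Set Ordinal, IsClubIn lam C → (S ∩ C).Nonempty

theorem isClubIn_Iio {l : Cardinal.{u}} (hl : ℵ₀ ≤ l) : IsClubIn l.ord (Set.Iio l.ord) := by
  refine ⟨subset_rfl, fun s _ _ hs ↦ hs, fun α hα ↦ ?_⟩
  have hα' := (isSuccLimit_ord hl).succ_lt hα
  exact ⟨Order.succ α, hα', Order.lt_succ α, hα'⟩

theorem ClosedIn.diagonalInter {T : Type v} {lam : Ordinal.{u}}
    {D : Ordinal.{u} → T → Set Ordinal.{u}}
    (hD : ∀ γ t, ClosedIn lam (D γ t)) :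
    ClosedIn lam {β | β < lam ∧ ∀ γ < β, ∀ t, β ∈ D γ t} := by
  intro s hs hne hlt
  refine ⟨hlt, fun γ hγ t ↦ ?_⟩
  have hbdd : BddAbove s := ⟨lam, fun x hx ↦ (hs hx).1.le⟩
  obtain ⟨ξ, hξ, hγξ⟩ := exists_lt_of_lt_csSup hne hγ
  have htail : sSup {x ∈ s | γ < x} = sSup s := by
    apply le_antisymm
    · exact csSup_le_csSup hbdd ⟨ξ, hξ, hγξ⟩ (Set.sep_subset _ _)
    · refine csSup_le hne fun x hx ↦ ?_
      have hbdd' : BddAbove {x ∈ s | γ < x} := hbdd.mono (Set.sep_subset _ _)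
      rcases lt_or_ge γ x with h | h
      · exact le_csSup hbdd' ⟨hx, h⟩
      · exact (h.trans hγξ.le).trans (le_csSup hbdd' ⟨hξ, hγξ⟩)
  rw [← htail] at hlt ⊢
  exact hD γ t _ (fun x hx ↦ (hs hx.1).2 γ hx.2 t) ⟨ξ, hξ, hγξ⟩ hlt

theorem UnboundedIn.diagonalInter {T : Type u} {l : Cardinal.{u}} (hreg : l.IsRegular)
    (hunc : ℵ₀ < l) (hT : #T < l) {D : Ordinal.{u} → T → Set Ordinal.{u}}
    (hD : ∀ γ t, IsClubIn l.ord (D γ t)) :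
    UnboundedIn l.ord {β | β < l.ord ∧ ∀ γ < β, ∀ t, β ∈ D γ t} := by
  intro α hα
  have hnext : ∀ γ t x, ∃ y, x < l.ord → y ∈ D γ t ∧ x < y ∧ y < l.ord := fun γ t x ↦ by
    by_cases hx : x < l.ord
    · obtain ⟨y, hy⟩ := (hD γ t).2.2 x hx
      exact ⟨y, fun _ ↦ hy⟩
    · exact ⟨0, fun h ↦ absurd h hx⟩
  choose next hnext using hnext
  let bound (x : Ordinal.{u}) : Ordinal.{u} :=
    max x (⨆ p : x.ToType × T, next p.1.toOrd p.2 x)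
  have hbound {x} (hx : x < l.ord) : bound x < l.ord := by
    refine max_lt hx (Ordinal.iSup_lt_of_lt_cof ?_ fun p ↦ (hnext _ _ _ hx).2.2)
    rw [hreg.cof_ord, mk_prod, lift_id, lift_id, mk_toType]
    exact mul_lt_of_lt hreg.aleph0_le (lt_ord.1 hx) hT
  have hnext_le {γ x} (hγ : γ < x) (t : T) : next γ t x ≤ bound x := by
    refine le_max_of_le_right ?_
    simpa using Ordinal.le_iSup (fun p : x.ToType × T ↦ next p.1.toOrd p.2 x)
      (Ordinal.ToType.mk ⟨γ, hγ⟩, t)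
  let x (n : ℕ) : Ordinal.{u} := bound^[n] (Order.succ α)
  have hx_succ (n : ℕ) : x (n + 1) = bound (x n) := Function.iterate_succ_apply' ..
  have hx_lt (n : ℕ) : x n < l.ord := by
    induction n with
    | zero => exact (isSuccLimit_ord hunc.le).succ_lt hα
    | succ n ih => rw [hx_succ]; exact hbound ih
  have hx_mono : Monotone x :=
    monotone_nat_of_le_succ fun n ↦ by rw [hx_succ]; exact le_max_left _ _
  have hx_le (n : ℕ) : x n ≤ ⨆ n, x n := Ordinal.le_iSup x n
  have hsup : ⨆ n, x n < l.ord := by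
    refine Ordinal.lift_iSup_lt_of_lt_cof ?_ hx_lt
    simpa [hreg.cof_ord] using hunc
  refine ⟨⨆ n, x n, ⟨hsup, fun γ hγ t ↦ ?_⟩, (Order.lt_succ α).trans_le (hx_le 0), hsup⟩
  obtain ⟨n, hn⟩ := Ordinal.lt_iSup_iff.1 hγ
  have heq : sSup (Set.range fun m ↦ next γ t (x (n + m))) = ⨆ n, x n := by
    apply le_antisymm
    · refine csSup_le (Set.range_nonempty _) ?_
      rintro _ ⟨m, rfl⟩
      refine (hnext_le (hn.trans_le (hx_mono (Nat.le_add_right n m))) t).trans ?_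
      rw [← hx_succ]
      exact hx_le _
    · refine Ordinal.iSup_le fun m ↦ (hx_mono (Nat.le_add_left m n)).trans ?_
      exact (hnext γ t _ (hx_lt _)).2.1.le.trans
        (Ordinal.le_iSup (fun m ↦ next γ t (x (n + m))) m)
  rw [← heq] at hsup ⊢
  refine (hD γ t).2.1 _ ?_ (Set.range_nonempty _) hsup
  rintro _ ⟨m, rfl⟩
  exact (hnext γ t _ (hx_lt _)).1

/-- The diagonal intersection of fewer than `l` clubs at each index is a club of `l`. -/
theorem IsClubIn.diagonalInter {T : Type u} {l : Cardinal.{u}} (hreg : l.IsRegular)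
    (hunc : ℵ₀ < l) (hT : #T < l) {D : Ordinal.{u} → T → Set Ordinal.{u}}
    (hD : ∀ γ t, IsClubIn l.ord (D γ t)) :
    IsClubIn l.ord {β | β < l.ord ∧ ∀ γ < β, ∀ t, β ∈ D γ t} :=
  ⟨fun _ h ↦ h.1, .diagonalInter fun γ t ↦ (hD γ t).2.1, .diagonalInter hreg hunc hT hD⟩

/-- Let `l` be a regular uncountable cardinal, `T` a set of cardinality `< l`, and
`g` a function from pairs of ordinals below `l` to `T`.  Then the set of `β < l` such
that for every `γ < β` the set `{ξ < l : g γ ξ = g γ β}` is stationary in `l`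
contains a club of `l`. -/
theorem stmt3 {T : Type u} (l : Cardinal.{u}) (hreg : l.IsRegular) (hunc : ℵ₀ < l)
    (hT : #T < l) (g : Ordinal.{u} → Ordinal.{u} → T) :
    ∃ C : Set Ordinal.{u}, IsClubIn l.ord C ∧
      C ⊆ {β | β < l.ord ∧ ∀ γ < β,
        StationaryIn l.ord {ξ | ξ < l.ord ∧ g γ ξ = g γ β}} := by
  have hD : ∀ γ t, ∃ D, IsClubIn l.ord D ∧ (¬ StationaryIn l.ord {ξ | ξ < l.ord ∧ g γ ξ = t} →
      ¬ ({ξ | ξ < l.ord ∧ g γ ξ = t} ∩ D).Nonempty) := fun γ t ↦ by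
    by_cases h : StationaryIn l.ord {ξ | ξ < l.ord ∧ g γ ξ = t}
    · exact ⟨_, isClubIn_Iio hunc.le, fun h' ↦ absurd h h'⟩
    · obtain ⟨D, hD, hdisj⟩ : ∃ D, IsClubIn l.ord D ∧
          ¬ ({ξ | ξ < l.ord ∧ g γ ξ = t} ∩ D).Nonempty := by
        simpa only [StationaryIn, not_forall, exists_prop] using h
      exact ⟨D, hD, fun _ ↦ hdisj⟩
  choose D hclub hdisj using hD
  refine ⟨_, .diagonalInter hreg hunc hT hclub, fun β hβ ↦ ⟨hβ.1, fun γ hγ ↦ ?_⟩⟩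
  by_contra hns
  exact hdisj γ _ hns ⟨β, ⟨hβ.1, rfl⟩, hβ.2 γ hγ _⟩
end

section
/- Let λ be a regular uncountable cardinal, let μ be a regular cardinal with μ < λ, let T be a set of cardinality strictly less than λ, and let g be a function from pairs of ordinals below λ to T. Then the set of ordinals β < λ such that the cofinality of β equals μ and, for every γ < β, the set {ξ < λ : g(γ,ξ) = g(γ,β)} is stationary in λ, is itself stationary in λ. -/
open Cardinal

open Set in
theorem Cardinal.IsRegular.iSup_Iio_add_one_lt_ord {l : Cardinal.{u}} (hreg : l.IsRegular)
    {a : Ordinal.{u}} (ha : a < l.ord) {f : Iio a → Ordinal.{u}} (hf : ∀ i, f i < l.ord) :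
    ⨆ i, f i + 1 < l.ord := by
  refine Ordinal.lift_iSup_add_one_lt_of_lt_cof ?_ hf
  rw [← Ordinal.lift_cof, hreg.cof_ord, Cardinal.mk_Iio_ordinal, Cardinal.lift_id'.{u, u + 1},
    Cardinal.lift_lt]
  exact Cardinal.lt_ord.1 ha

theorem IsClubIn.mem_of_forall_lt {lam β : Ordinal} {C : Set Ordinal} (hC : IsClubIn lam C)
    (hβ : β < lam) (hβ₀ : 0 < β) (h : ∀ α < β, ∃ ξ ∈ C, α < ξ ∧ ξ ≤ β) : β ∈ C := by
  have hlub : IsLUB (C ∩ Set.Iic β) β := by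
    refine ⟨fun x hx ↦ hx.2, fun b hb ↦ ?_⟩
    by_contra! hlt
    obtain ⟨ξ, hξ, hbξ, hξβ⟩ := h b hlt
    exact (hb ⟨hξ, hξβ⟩).not_gt hbξ
  have hne : (C ∩ Set.Iic β).Nonempty := by
    obtain ⟨ξ, hξ, -, hξβ⟩ := h 0 hβ₀
    exact ⟨ξ, hξ, hξβ⟩
  have hsup := hlub.csSup_eq hne
  rw [← hsup]
  exact hC.2.1 _ Set.inter_subset_left hne (hsup.trans_lt hβ)

theorem isClubIn_Iio_s4 {lam : Ordinal} (hlam : Order.IsSuccLimit lam) :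
    IsClubIn lam (Set.Iio lam) :=
  ⟨subset_rfl, fun _ _ _ h ↦ h, fun α hα ↦
    ⟨Order.succ α, hlam.succ_lt hα, Order.lt_succ α, hlam.succ_lt hα⟩⟩

/-- The least sequence of ordinals whose `i`-th term exceeds the value of `F` at each earlier
term. -/
noncomputable def iterateAbove (F : Ordinal.{u} → Ordinal.{u}) (i : Ordinal.{u}) : Ordinal.{u} :=
  ⨆ j : Set.Iio i, (F (iterateAbove F j) + 1)
termination_by i
decreasing_by exact j.2

theorem lt_iterateAbove (F : Ordinal.{u} → Ordinal.{u}) {i j : Ordinal.{u}} (h : j < i) :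
    F (iterateAbove F j) < iterateAbove F i := by
  rw [iterateAbove.eq_1 F i]
  exact Ordinal.lt_iSup_add_one (fun j : Set.Iio i ↦ F (iterateAbove F j)) ⟨j, h⟩

theorem iterateAbove_lt_ord {l : Cardinal.{u}} (hreg : l.IsRegular)
    {F : Ordinal.{u} → Ordinal.{u}} (hF : ∀ α < l.ord, F α < l.ord) (i : Ordinal.{u})
    (hi : i < l.ord) : iterateAbove F i < l.ord := by
  induction i using WellFoundedLT.induction with
  | ind i ih =>
    rw [iterateAbove]
    exact hreg.iSup_Iio_add_one_lt_ord hi fun j ↦ hF _ (ih j j.2 (j.2.trans hi))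

/-- A function on a regular cardinal that strictly increases its arguments has closure points of
every smaller regular cofinality. -/
theorem exists_cof_eq_forall_exists_apply_lt {l μ : Cardinal.{u}} (hreg : l.IsRegular)
    (hμreg : μ.IsRegular) (hμl : μ < l) {F : Ordinal.{u} → Ordinal.{u}}
    (hF : ∀ α < l.ord, F α < l.ord) (hlt : ∀ α < l.ord, α < F α) :
    ∃ β < l.ord, β.cof = μ ∧ ∀ α < β, ∃ δ, α ≤ δ ∧ δ < β ∧ F δ < β := by
  have hμord : μ.ord < l.ord := Cardinal.ord_lt_ord.2 hμl
  have hs (i : Set.Iio μ.ord) : iterateAbove F i < l.ord :=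
    iterateAbove_lt_ord hreg hF i (i.2.trans hμord)
  have hmono : StrictMono fun i : Set.Iio μ.ord ↦ iterateAbove F i := fun i j hij ↦
    (hlt _ (hs i)).trans (lt_iterateAbove F hij)
  refine ⟨⨆ i : Set.Iio μ.ord, iterateAbove F i + 1,
    hreg.iSup_Iio_add_one_lt_ord hμord hs, ?_, fun α hα ↦ ?_⟩
  · rw [Ordinal.cof_iSup_Iio_add_one hmono, hμreg.cof_ord]
  · obtain ⟨i, hi⟩ := Ordinal.lt_iSup_add_one_iff.1 hα
    have hsucc : Order.succ i.1 < μ.ord :=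
      (Cardinal.isSuccLimit_ord hμreg.aleph0_le).succ_lt i.2
    have hbelow := Ordinal.lt_iSup_add_one (fun i : Set.Iio μ.ord ↦ iterateAbove F i)
    exact ⟨_, hi, hbelow i,
      (lt_iterateAbove F (Order.lt_succ i.1)).trans (hbelow ⟨_, hsucc⟩)⟩

/-- The diagonal intersection of fewer than `l` many families of clubs contains points of every
regular cofinality below `l`. -/
theorem exists_cof_eq_forall_mem_club {ι : Type u} {l μ : Cardinal.{u}} (hreg : l.IsRegular)
    (hμreg : μ.IsRegular) (hμl : μ < l) (hι : #ι < l) (C : Ordinal.{u} → ι → Set Ordinal.{u})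
    (hC : ∀ γ t, IsClubIn l.ord (C γ t)) :
    ∃ β < l.ord, 0 < β ∧ β.cof = μ ∧ ∀ γ < β, ∀ t, β ∈ C γ t := by
  have hlim : Order.IsSuccLimit l.ord := Cardinal.isSuccLimit_ord hreg.aleph0_le
  have hstep (α : Ordinal.{u}) : ∃ δ, α < l.ord →
      δ < l.ord ∧ α < δ ∧ ∀ γ ≤ α, ∀ t, ∃ ξ ∈ C γ t, α < ξ ∧ ξ ≤ δ := by
    by_cases hα : α < l.ord
    swap
    · exact ⟨0, fun h ↦ absurd h hα⟩
    choose next hnext_mem hlt_next hnext_lt using fun γ t ↦ (hC γ t).2.2 α hα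
    have hinner (γ : Ordinal.{u}) : max α (⨆ t, next γ t + 1) < l.ord :=
      max_lt hα (Ordinal.iSup_add_one_lt_of_lt_cof (by rwa [hreg.cof_ord]) (hnext_lt γ))
    have houter := Ordinal.lt_iSup_add_one
      fun γ : Set.Iio (Order.succ α) ↦ max α (⨆ t, next γ t + 1)
    refine ⟨⨆ γ : Set.Iio (Order.succ α), max α (⨆ t, next γ t + 1) + 1, fun _ ↦
      ⟨hreg.iSup_Iio_add_one_lt_ord (hlim.succ_lt hα) fun γ ↦ hinner γ,
        (le_max_left _ _).trans_lt (houter ⟨α, Order.lt_succ α⟩), fun γ hγ t ↦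
        ⟨next γ t, hnext_mem γ t, hlt_next γ t, ?_⟩⟩⟩
    exact ((Ordinal.lt_iSup_add_one (next γ) t).le.trans (le_max_right _ _)).trans
      (houter ⟨γ, Order.lt_succ_of_le hγ⟩).le
  choose F hF using hstep
  obtain ⟨β, hβ, hcof, hclosure⟩ := exists_cof_eq_forall_exists_apply_lt hreg hμreg hμl
    (fun α hα ↦ (hF α hα).1) (fun α hα ↦ (hF α hα).2.1)
  have hβ₀ : 0 < β := by
    rw [pos_iff_ne_zero]
    rintro rfl
    exact hμreg.ne_zero (by simpa using hcof.symm)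
  refine ⟨β, hβ, hβ₀, hcof, fun γ hγ t ↦ (hC γ t).mem_of_forall_lt hβ hβ₀ fun α hα ↦ ?_⟩
  obtain ⟨δ, hδ, hδβ, hFδ⟩ := hclosure (max α γ) (max_lt hα hγ)
  obtain ⟨ξ, hξ, hδξ, hξF⟩ := (hF δ (hδβ.trans hβ)).2.2 γ ((le_max_right _ _).trans hδ) t
  exact ⟨ξ, hξ, ((le_max_left _ _).trans hδ).trans_lt hδξ, hξF.trans hFδ.le⟩

/-- Let `l` be a regular uncountable cardinal, `μ < l` a regular cardinal, `T` a set of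
cardinality `< l`, and `g` a function from pairs of ordinals below `l` to `T`.  Then the
set of `β < l` of cofinality `μ` such that for every `γ < β` the set
`{ξ < l : g γ ξ = g γ β}` is stationary in `l` is itself stationary in `l`. -/
theorem stmt4 {T : Type u} (l μ : Cardinal.{u}) (hreg : l.IsRegular) (hunc : ℵ₀ < l)
    (hμreg : μ.IsRegular) (hμl : μ < l)
    (hT : #T < l) (g : Ordinal.{u} → Ordinal.{u} → T) :
    StationaryIn l.ord {β | β < l.ord ∧ β.cof = μ ∧ ∀ γ < β,
      StationaryIn l.ord {ξ | ξ < l.ord ∧ g γ ξ = g γ β}} := by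
  intro D hD
  have hclub (γ : Ordinal.{u}) (t : T) : ∃ C, IsClubIn l.ord C ∧
      (¬ StationaryIn l.ord {ξ | ξ < l.ord ∧ g γ ξ = t} →
        ({ξ | ξ < l.ord ∧ g γ ξ = t} ∩ C) = ∅) := by
    by_cases h : StationaryIn l.ord {ξ | ξ < l.ord ∧ g γ ξ = t}
    · exact ⟨_, isClubIn_Iio_s4 (Cardinal.isSuccLimit_ord hreg.aleph0_le), fun h' ↦ absurd h h'⟩
    · have h' := h
      simp only [StationaryIn, not_forall, Set.not_nonempty_iff_eq_empty] at h'
      obtain ⟨C, hC, hdisj⟩ := h'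
      exact ⟨C, hC, fun _ ↦ hdisj⟩
  choose C hC hdisj using hclub
  obtain ⟨β, hβ, hβ₀, hcof, hmem⟩ := exists_cof_eq_forall_mem_club (ι := Option T)
    hreg hμreg hμl
    (by
      rw [Cardinal.mk_option]
      exact Cardinal.add_lt_of_lt hreg.aleph0_le hT (Cardinal.one_lt_aleph0.trans hunc))
    (fun γ t ↦ t.elim D (C γ))
    (by rintro γ (_ | t); exacts [hD, hC γ t])
  refine ⟨β, ⟨hβ, hcof, fun γ hγ ↦ ?_⟩, hmem 0 hβ₀ none⟩
  by_contra hns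
  exact (hdisj γ (g γ β) hns).subset ⟨⟨hβ, rfl⟩, hmem γ hγ (some (g γ β))⟩
end
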